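/- arXiv:1001.2625 — 4 statements merged into one kernel-verified Lean document; each statement's English description precedes it below -/
import Mathlib

section
/- The scaled L1 distance lower-bounds the cost of every feasible flow: let ι be a finite type, c : ι → ι → ℝ a ground cost with c(p,q) ≥ 0 for all p, q and c(p,q) ≥ 1 whenever p ≠ q, and a, b : ι → ℝ mass vectors. Then every flow f feasible for (a,b) satisfies Σ_{p,q} c(p,q)·f(p,q) ≥ (1/2) · Σ_{p} |a(p) − b(p)|. In particular, half the L1 distance is a lower bound for the earth mover's distance EMD_c(a,b). -/
/-- A flow `f` is feasible for mass vectors `(a, b)` if it is nonnegative, its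
row sums equal `a`, and its column sums equal `b`. -/
def IsFeasibleFlow {ι : Type*} [Fintype ι] (f : ι → ι → ℝ) (a b : ι → ℝ) : Prop :=
  (∀ p q, 0 ≤ f p q) ∧ (∀ p, ∑ q : ι, f p q = a p) ∧ (∀ q, ∑ p : ι, f p q = b q)

/-- The scaled L1 distance lower-bounds the cost of every feasible flow: if the
ground cost `c` is nonnegative and at least `1` off the diagonal, then every
flow feasible for `(a, b)` has cost at least half the L1 distance between `a`
and `b`.  In particular, half the L1 distance lower-bounds the earth mover's
distance `EMD_c(a,b)`. -/
theorem half_l1_le_flow_cost {ι : Type*} [Fintype ι] (c : ι → ι → ℝ)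
    (hc0 : ∀ p q, 0 ≤ c p q) (hc1 : ∀ p q, p ≠ q → 1 ≤ c p q)
    (a b : ι → ℝ) (f : ι → ι → ℝ) (hf : IsFeasibleFlow f a b) :
    (1 / 2) * ∑ p : ι, |a p - b p| ≤ ∑ p : ι, ∑ q : ι, c p q * f p q := by
  obtain ⟨hf0, hrow, hcol⟩ := hf
  have pointwise : ∀ p q, |f p q - f q p| ≤ c p q * f p q + c q p * f q p := by
    intro p q
    rcases eq_or_ne p q with rfl | hpq
    · simpa using mul_nonneg (hc0 p p) (hf0 p p)
    · have h₁ := le_mul_of_one_le_left (hf0 p q) (hc1 p q hpq)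
      have h₂ := le_mul_of_one_le_left (hf0 q p) (hc1 q p hpq.symm)
      rw [abs_le]
      constructor <;> linarith [hf0 p q, hf0 q p]
  have marginal : ∀ p, |a p - b p| ≤ ∑ q : ι, (c p q * f p q + c q p * f q p) := by
    intro p
    rw [← hrow p, ← hcol p, ← Finset.sum_sub_distrib]
    exact (Finset.abs_sum_le_sum_abs _ _).trans (Finset.sum_le_sum fun q _ => pointwise p q)
  have total := Finset.sum_le_sum fun p (_ : p ∈ Finset.univ) => marginal p
  simp only [Finset.sum_add_distrib] at total
  have swap : ∑ p : ι, ∑ q : ι, c q p * f q p = ∑ p : ι, ∑ q : ι, c p q * f p q :=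
    Finset.sum_comm
  linarith
end

section
/- The earth mover's distance computed on the reduced ontology lower-bounds the earth mover's distance on the full ontology: let ι, κ be finite types, g : ι → κ, and let c : ι → ι → ℝ and c' : κ → κ → ℝ be nonnegative ground costs with c'(g(p), g(q)) ≤ c(p,q) for all p, q ∈ ι. Let a, b : ι → ℝ be mass vectors admitting at least one feasible flow, and let a', b' be their pushforwards along g (a'(u) = Σ_{p : g(p)=u} a(p), and similarly for b'). Then EMD_{c'}(a', b') ≤ EMD_c(a, b). -/
/-- The earth mover's distance: the infimum of the costs of flows feasible for
`(a, b)`, with ground cost `c`. -/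
noncomputable def EMD {ι : Type*} [Fintype ι] (c : ι → ι → ℝ) (a b : ι → ℝ) : ℝ :=
  sInf {x | ∃ f : ι → ι → ℝ, IsFeasibleFlow f a b ∧ x = ∑ p : ι, ∑ q : ι, c p q * f p q}

/-- The pushforward of a flow along a map `g`. -/
def pushFlow {ι κ : Type*} [Fintype ι] [DecidableEq κ] (g : ι → κ) (f : ι → ι → ℝ) :
    κ → κ → ℝ :=
  fun u v => ∑ p ∈ Finset.univ.filter (fun p => g p = u),
    ∑ q ∈ Finset.univ.filter (fun q => g q = v), f p q

theorem IsFeasibleFlow.pushFlow {ι κ : Type*} [Fintype ι] [Fintype κ] [DecidableEq κ]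
    (g : ι → κ) {f : ι → ι → ℝ} {a b : ι → ℝ} (hf : IsFeasibleFlow f a b) :
    IsFeasibleFlow (pushFlow g f)
      (fun u => ∑ p ∈ Finset.univ.filter (fun p => g p = u), a p)
      (fun v => ∑ q ∈ Finset.univ.filter (fun q => g q = v), b q) := by
  obtain ⟨hnonneg, hrow, hcol⟩ := hf
  refine ⟨fun u v => Finset.sum_nonneg fun p _ => Finset.sum_nonneg fun q _ => hnonneg p q,
    fun u => ?_, fun v => ?_⟩
  · unfold _root_.pushFlow
    rw [Finset.sum_comm]
    exact Finset.sum_congr rfl fun p _ => by rw [Finset.sum_fiberwise, hrow]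
  · unfold _root_.pushFlow
    rw [Finset.sum_fiberwise, Finset.sum_comm]
    exact Finset.sum_congr rfl fun q _ => hcol q

theorem cost_pushFlow {ι κ : Type*} [Fintype ι] [Fintype κ] [DecidableEq κ]
    (g : ι → κ) (c' : κ → κ → ℝ) (f : ι → ι → ℝ) :
    ∑ u : κ, ∑ v : κ, c' u v * pushFlow g f u v =
      ∑ p : ι, ∑ q : ι, c' (g p) (g q) * f p q := by
  rw [← Finset.sum_fiberwise Finset.univ g]
  refine Finset.sum_congr rfl fun u _ => ?_
  simp only [pushFlow, Finset.mul_sum]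
  rw [Finset.sum_comm]
  refine Finset.sum_congr rfl fun p hp => ?_
  rw [← Finset.sum_fiberwise Finset.univ g]
  refine Finset.sum_congr rfl fun v _ => Finset.sum_congr rfl fun q hq => ?_
  rw [(Finset.mem_filter.mp hp).2, (Finset.mem_filter.mp hq).2]

/-- The earth mover's distance computed on the reduced ontology lower-bounds the
earth mover's distance on the full ontology: pushing the masses forward along
the term-reduction map `g` (with compatible ground costs) can only decrease the
EMD. -/
theorem emd_reduced_le_emd_full {ι κ : Type*} [Fintype ι] [Fintype κ]
    [DecidableEq κ] (g : ι → κ) (c : ι → ι → ℝ) (c' : κ → κ → ℝ)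
    (hc : ∀ p q, 0 ≤ c p q) (hc' : ∀ u v, 0 ≤ c' u v)
    (hcc' : ∀ p q, c' (g p) (g q) ≤ c p q)
    (a b : ι → ℝ) (hab : ∃ f : ι → ι → ℝ, IsFeasibleFlow f a b) :
    EMD c' (fun u => ∑ p ∈ Finset.univ.filter (fun p => g p = u), a p)
        (fun v => ∑ q ∈ Finset.univ.filter (fun q => g q = v), b q) ≤
      EMD c a b := by
  obtain ⟨f₀, hf₀⟩ := hab
  refine le_csInf ⟨_, f₀, hf₀, rfl⟩ ?_
  rintro _ ⟨f, hf, rfl⟩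
  refine le_trans (b := ∑ u : κ, ∑ v : κ, c' u v * pushFlow g f u v)
    (csInf_le ⟨0, ?_⟩ ⟨_, hf.pushFlow g, rfl⟩) ?_
  · rintro _ ⟨f', hf', rfl⟩
    exact Finset.sum_nonneg fun u _ => Finset.sum_nonneg fun v _ =>
      mul_nonneg (hc' u v) (hf'.1 u v)
  · rw [cost_pushFlow]
    exact Finset.sum_le_sum fun p _ => Finset.sum_le_sum fun q _ =>
      mul_le_mul_of_nonneg_right (hcc' p q) (hf.1 p q)
end

section
/- Lower bound for two multiple-span objects (Case 2): let A, B be nonempty finite subsets of a pseudometric space X, t ∈ X, and σ a function assigning to each point its subtree (class), such that dist(a,b) = dist(a,t) + dist(t,b) whenever σ(a) ≠ σ(b). Suppose both A and B are multiple-span, i.e., A contains two elements a, a' with σ(a) ≠ σ(a'), and B contains two elements b, b' with σ(b) ≠ σ(b'). Then d_avg(A,B) ≥ (w_A + w_B)/(|A|·|B|), where w_A = Σ_{a∈A} dist(a,t) and w_B = Σ_{b∈B} dist(b,t). -/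
/-- The average pairwise distance between nonempty finite subsets of a
pseudometric space: `d_avg(A,B) = (1/(|A|·|B|)) · Σ_{a∈A} Σ_{b∈B} dist(a,b)`. -/
noncomputable def davg {X : Type*} [PseudoMetricSpace X] (A B : Finset X) : ℝ :=
  ((A.card : ℝ) * (B.card : ℝ))⁻¹ * ∑ a ∈ A, ∑ b ∈ B, dist a b

open scoped Classical in
/-- If `C` meets two classes of `σ`, then any class `s` differs from that of some element
of `C`, so a nonnegative `r` is counted at least once. -/
theorem le_sum_ite_ne_of_exists_ne {X S : Type*} (C : Finset X) (σ : X → S)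
    (hC : ∃ c ∈ C, ∃ c' ∈ C, σ c ≠ σ c') (s : S) {r : ℝ} (hr : 0 ≤ r) :
    r ≤ ∑ c ∈ C, if s ≠ σ c then r else 0 := by
  obtain ⟨c, hc, hs⟩ : ∃ c ∈ C, s ≠ σ c := by
    obtain ⟨c, hc, c', hc', hne⟩ := hC
    by_cases hs : s = σ c
    · exact ⟨c', hc', hs ▸ hne⟩
    · exact ⟨c, hc, hs⟩
  calc r = if s ≠ σ c then r else 0 := (if_pos hs).symm
    _ ≤ _ := Finset.single_le_sum (f := fun c => if s ≠ σ c then r else 0)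
      (fun i _ => by split_ifs <;> simp [hr]) hc

/-- Case 2: lower bound for two multiple-span objects.  If paths between points
in different subtrees (classes, as given by `σ`) pass through the node `t`, and
both `A` and `B` span multiple subtrees, then
`d_avg(A,B) ≥ (w_A + w_B)/(|A|·|B|)`, where `w_A = Σ_{a∈A} dist(a,t)` and
`w_B = Σ_{b∈B} dist(b,t)`. -/
theorem davg_lb_multiple_multiple {X S : Type*} [PseudoMetricSpace X]
    (A B : Finset X) (hA : A.Nonempty) (hB : B.Nonempty) (t : X) (σ : X → S)
    (h : ∀ a b : X, σ a ≠ σ b → dist a b = dist a t + dist t b)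
    (hAspan : ∃ a ∈ A, ∃ a' ∈ A, σ a ≠ σ a')
    (hBspan : ∃ b ∈ B, ∃ b' ∈ B, σ b ≠ σ b') :
    davg A B ≥ ((∑ a ∈ A, dist a t) + (∑ b ∈ B, dist b t)) /
      ((A.card : ℝ) * (B.card : ℝ)) := by
  classical
  rw [davg, ge_iff_le, div_eq_inv_mul]
  refine mul_le_mul_of_nonneg_left ?_ (by positivity)
  calc (∑ a ∈ A, dist a t) + ∑ b ∈ B, dist b t
      ≤ (∑ a ∈ A, ∑ b ∈ B, if σ a ≠ σ b then dist a t else 0)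
        + ∑ b ∈ B, ∑ a ∈ A, if σ b ≠ σ a then dist b t else 0 :=
        add_le_add
          (Finset.sum_le_sum fun a _ => le_sum_ite_ne_of_exists_ne B σ hBspan (σ a) dist_nonneg)
          (Finset.sum_le_sum fun b _ => le_sum_ite_ne_of_exists_ne A σ hAspan (σ b) dist_nonneg)
    _ = ∑ a ∈ A, ∑ b ∈ B, ((if σ a ≠ σ b then dist a t else 0)
        + if σ b ≠ σ a then dist b t else 0) := by
        rw [Finset.sum_comm (s := B)]
        simp only [Finset.sum_add_distrib]
    _ ≤ ∑ a ∈ A, ∑ b ∈ B, dist a b := by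
        refine Finset.sum_le_sum fun a _ => Finset.sum_le_sum fun b _ => ?_
        by_cases hab : σ a = σ b
        · simp [hab]
        · rw [if_pos hab, if_pos (Ne.symm hab), h a b hab, dist_comm b t]
end

section
/- Lower bound for a single-span and a multiple-span object (Case 3): let A, B be nonempty finite subsets of a pseudometric space X, t ∈ X, and σ a function assigning to each point its subtree (class), such that dist(a,b) = dist(a,t) + dist(t,b) whenever σ(a) ≠ σ(b). Suppose A is single-span, i.e., σ(a) = σ(a') for all a, a' ∈ A, and B is multiple-span, i.e., B contains two elements b, b' with σ(b) ≠ σ(b'). Then d_avg(A,B) ≥ w_A/(|A|·|B|), where w_A = Σ_{a∈A} dist(a,t). -/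
/-- Case 3: lower bound for a single-span object `A` and a multiple-span object
`B`.  If paths between points in different subtrees (classes, as given by `σ`)
pass through the node `t`, `A` lies in a single subtree, and `B` spans multiple
subtrees, then `d_avg(A,B) ≥ w_A/(|A|·|B|)`, where `w_A = Σ_{a∈A} dist(a,t)`. -/
theorem davg_lb_single_multiple {X S : Type*} [PseudoMetricSpace X]
    (A B : Finset X) (hA : A.Nonempty) (hB : B.Nonempty) (t : X) (σ : X → S)
    (h : ∀ a b : X, σ a ≠ σ b → dist a b = dist a t + dist t b)
    (hAspan : ∀ a ∈ A, ∀ a' ∈ A, σ a = σ a')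
    (hBspan : ∃ b ∈ B, ∃ b' ∈ B, σ b ≠ σ b') :
    davg A B ≥ (∑ a ∈ A, dist a t) / ((A.card : ℝ) * (B.card : ℝ)) := by
  obtain ⟨b, hb, b', hb', hne⟩ := hBspan
  have key : ∑ a ∈ A, dist a t ≤ ∑ a ∈ A, ∑ b ∈ B, dist a b := by
    refine Finset.sum_le_sum fun a _ => ?_
    obtain ⟨c, hc, hac⟩ : ∃ c ∈ B, σ a ≠ σ c := by
      by_cases hab : σ a = σ b
      · exact ⟨b', hb', hab ▸ hne⟩
      · exact ⟨b, hb, hab⟩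
    calc dist a t ≤ dist a t + dist t c := le_add_of_nonneg_right dist_nonneg
      _ = dist a c := (h a c hac).symm
      _ ≤ ∑ b ∈ B, dist a b :=
        Finset.single_le_sum (f := fun b => dist a b) (fun _ _ => dist_nonneg) hc
  rw [ge_iff_le, davg, div_eq_inv_mul]
  exact mul_le_mul_of_nonneg_left key (by positivity)
end
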